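/- arXiv:1504.03632 — 5 statements merged into one kernel-verified Lean document; each statement's English description precedes it below -/
import Mathlib

section
/- (Probabilistic core of Theorem 2) Under the hierarchical request model, for every ε̄ > 0, Pr{ max_{1≤i≤N} |p̂_i − p_i| > ε̄ } ≤ 2N·exp(−λ_u·π·R²·(1 − exp(−λ_r·τ·(1 − e^{−2ε̄²})))). -/
open MeasureTheory

lemma aux_hoeff (p s : ℝ) (h0 : 0 ≤ p) (h1 : p ≤ 1) :
    p * Real.exp (s * (1 - p)) + (1 - p) * Real.exp (s * (0 - p)) ≤ Real.exp (s ^ 2 / 8) := by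
  let μ : Measure ℝ := ENNReal.ofReal p • Measure.dirac 1 + ENNReal.ofReal (1 - p) • Measure.dirac 0
  have hμ : IsProbabilityMeasure μ := ⟨by
    simp only [μ, Measure.add_apply, Measure.smul_apply, measure_univ, smul_eq_mul, mul_one]
    rw [← ENNReal.ofReal_add h0 (by linarith)]
    simp⟩
  have key : ∀ f : ℝ → ℝ, ∫ x, f x ∂μ = p * f 1 + (1 - p) * f 0 := by
    intro f
    rw [integral_add_measure, integral_smul_measure, integral_smul_measure, integral_dirac,
      integral_dirac, ENNReal.toReal_ofReal h0, ENNReal.toReal_ofReal (by linarith)]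
    · simp
    · exact (integrable_dirac (by simp)).smul_measure (by simp)
    · exact (integrable_dirac (by simp)).smul_measure (by simp)
  have hb : ∀ᵐ x ∂μ, (fun x : ℝ => x) x ∈ Set.Icc (0 : ℝ) 1 := by
    rw [ae_add_measure_iff]
    constructor
    · refine Measure.ae_smul_measure ?_ _
      rw [ae_dirac_eq]; simp
    · refine Measure.ae_smul_measure ?_ _
      rw [ae_dirac_eq]; simp
  have h := (ProbabilityTheory.hasSubgaussianMGF_of_mem_Icc
    (μ := μ) (X := fun x : ℝ => x) aemeasurable_id hb).mgf_le s
  rw [key] at h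
  unfold ProbabilityTheory.mgf at h
  rw [key] at h
  simp only [mul_one, mul_zero, add_zero] at h
  refine h.trans_eq ?_
  congr 1
  simp
  ring

lemma aux_mgf {N : ℕ} (P : Fin N → ℝ) (hP0 : ∀ i, 0 ≤ P i) (hP1 : ∑ i, P i = 1)
    (n : ℕ) (i : Fin N) (s : ℝ) :
    ∑ y : Fin n → Fin N, (∏ l, P (y l)) *
      Real.exp (s * ∑ l, ((if y l = i then (1 : ℝ) else 0) - P i)) ≤ Real.exp (n * (s ^ 2 / 8)) := by
  have hle : P i ≤ 1 := hP1 ▸ Finset.single_le_sum (fun j _ => hP0 j) (Finset.mem_univ i)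
  have h1 : ∑ j, P j * Real.exp (s * ((if j = i then (1 : ℝ) else 0) - P i)) =
      P i * Real.exp (s * (1 - P i)) + (1 - P i) * Real.exp (s * (0 - P i)) := by
    rw [← Finset.add_sum_erase _ _ (Finset.mem_univ i)]
    have h2 : ∑ j ∈ Finset.univ.erase i, P j = 1 - P i := by
      have h3 := Finset.add_sum_erase Finset.univ P (Finset.mem_univ i)
      linarith
    have h4 : (1 - P i) * Real.exp (s * (0 - P i)) =
        ∑ j ∈ Finset.univ.erase i, P j * Real.exp (s * (0 - P i)) := by
      rw [← Finset.sum_mul, h2]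
    rw [h4]
    simp only [if_true]
    refine congrArg _ ?_
    refine Finset.sum_congr rfl fun j hj => ?_
    rw [if_neg (Finset.ne_of_mem_erase hj)]
  calc _ = (∑ j, P j * Real.exp (s * ((if j = i then (1 : ℝ) else 0) - P i))) ^ n := by
        rw [Fintype.sum_pow]
        refine Finset.sum_congr rfl fun y _ => ?_
        rw [Finset.prod_mul_distrib, Finset.mul_sum, Real.exp_sum]
    _ ≤ Real.exp (s ^ 2 / 8) ^ n := by
        refine pow_le_pow_left₀ (Finset.sum_nonneg fun j _ =>
          mul_nonneg (hP0 j) (Real.exp_pos _).le) ?_ n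
        rw [h1]; exact aux_hoeff _ _ (hP0 i) hle
    _ = _ := by rw [← Real.exp_nat_mul]

/-- empirical frequency is bad -/
def auxBad {N : ℕ} (P : Fin N → ℝ) (e : ℝ) (n : ℕ) (y : Fin n → Fin N) (i : Fin N) : Prop :=
  e < |(if n = 0 then 0 else (1 / (n : ℝ)) * ∑ l, if y l = i then (1 : ℝ) else 0) - P i|

open Classical in
lemma aux_tail {N : ℕ} (P : Fin N → ℝ) (hP0 : ∀ i, 0 ≤ P i) (hP1 : ∑ i, P i = 1)
    (n : ℕ) (i : Fin N) (e : ℝ) (he : 0 < e) :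
    ∑ y : Fin n → Fin N, (if auxBad P e n y i then ∏ l, P (y l) else 0) ≤
      2 * Real.exp (-2 * e ^ 2) ^ n := by
  have hpt : ∀ y : Fin n → Fin N, (if auxBad P e n y i then ∏ l, P (y l) else 0) ≤
      Real.exp (-4 * n * e ^ 2) * ((∏ l, P (y l)) *
        Real.exp ((4 * e) * ∑ l, ((if y l = i then (1 : ℝ) else 0) - P i))) +
      Real.exp (-4 * n * e ^ 2) * ((∏ l, P (y l)) *
        Real.exp ((-(4 * e)) * ∑ l, ((if y l = i then (1 : ℝ) else 0) - P i))) := by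
    intro y
    have hpr : 0 ≤ ∏ l, P (y l) := Finset.prod_nonneg fun l _ => hP0 _
    set S := ∑ l, ((if y l = i then (1 : ℝ) else 0) - P i) with hS
    split_ifs with hb
    · have hor : n * e ≤ S ∨ n * e ≤ -S := by
        rcases Nat.eq_zero_or_pos n with rfl | hn
        · left; simp [S]
        · have hn' : (0 : ℝ) < n := by exact_mod_cast hn
          unfold auxBad at hb
          rw [if_neg hn.ne'] at hb
          have hS2 : (1 / (n : ℝ)) * (∑ l, if y l = i then (1 : ℝ) else 0) - P i = S / n := by
            rw [hS, Finset.sum_sub_distrib]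
            simp only [Finset.sum_const, Finset.card_univ, Fintype.card_fin, nsmul_eq_mul]
            field_simp
          rw [hS2, abs_div, abs_of_pos hn', lt_div_iff₀ hn'] at hb
          rcases le_abs.mp hb.le with h | h
          · left; linarith
          · right; linarith
      have e1 : ∀ t : ℝ, Real.exp (-4 * n * e ^ 2) * ((∏ l, P (y l)) * Real.exp t) =
          (∏ l, P (y l)) * Real.exp (t - 4 * n * e ^ 2) := by
        intro t; rw [mul_left_comm, ← Real.exp_add]; ring_nf
      rw [e1, e1]
      have p1 := mul_nonneg hpr (Real.exp_pos (4 * e * S - 4 * n * e ^ 2)).le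
      have p2 := mul_nonneg hpr (Real.exp_pos (-(4 * e) * S - 4 * n * e ^ 2)).le
      rcases hor with h | h
      · have : 1 ≤ Real.exp (4 * e * S - 4 * n * e ^ 2) := Real.one_le_exp (by nlinarith)
        have := mul_le_mul_of_nonneg_left this hpr
        linarith
      · have : 1 ≤ Real.exp (-(4 * e) * S - 4 * n * e ^ 2) := Real.one_le_exp (by nlinarith)
        have := mul_le_mul_of_nonneg_left this hpr
        linarith
    · positivity
  refine (Finset.sum_le_sum fun y _ => hpt y).trans ?_
  rw [Finset.sum_add_distrib, ← Finset.mul_sum, ← Finset.mul_sum, two_mul]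
  have fin : ∀ s : ℝ, s ^ 2 = 16 * e ^ 2 → Real.exp (-4 * n * e ^ 2) *
      ∑ y : Fin n → Fin N, (∏ l, P (y l)) *
        Real.exp (s * ∑ l, ((if y l = i then (1 : ℝ) else 0) - P i)) ≤
      Real.exp (-2 * e ^ 2) ^ n := by
    intro s hs
    refine (mul_le_mul_of_nonneg_left (aux_mgf P hP0 hP1 n i s) (Real.exp_pos _).le).trans_eq ?_
    rw [← Real.exp_add, ← Real.exp_nat_mul, hs]; ring_nf
  exact add_le_add (fin _ (by ring)) (fin _ (by ring))

open Classical in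
lemma aux_tail2 {N : ℕ} (P : Fin N → ℝ) (hP0 : ∀ i, 0 ≤ P i) (hP1 : ∑ i, P i = 1)
    (n : ℕ) (e : ℝ) (he : 0 < e) :
    ∑ y : Fin n → Fin N, (if ∃ i, auxBad P e n y i then ∏ l, ENNReal.ofReal (P (y l)) else 0) ≤
      ENNReal.ofReal (2 * N * Real.exp (-2 * e ^ 2) ^ n) := by
  have h1 : ∀ y : Fin n → Fin N,
      (if ∃ i, auxBad P e n y i then ∏ l, ENNReal.ofReal (P (y l)) else 0) =
      ENNReal.ofReal (if ∃ i, auxBad P e n y i then ∏ l, P (y l) else 0) := by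
    intro y
    split_ifs
    · rw [ENNReal.ofReal_prod_of_nonneg fun l _ => hP0 _]
    · simp
  have hpr : ∀ y : Fin n → Fin N, 0 ≤ ∏ l, P (y l) := fun y => Finset.prod_nonneg fun l _ => hP0 _
  simp_rw [h1]
  rw [← ENNReal.ofReal_sum_of_nonneg (fun y _ => by split_ifs <;> simp [hpr])]
  refine ENNReal.ofReal_le_ofReal ?_
  calc _ ≤ ∑ y : Fin n → Fin N, ∑ i, (if auxBad P e n y i then ∏ l, P (y l) else 0) := by
        refine Finset.sum_le_sum fun y _ => ?_
        have hnn : ∀ i ∈ Finset.univ, 0 ≤ (if auxBad P e n y i then ∏ l, P (y l) else 0) :=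
          fun i _ => by split_ifs <;> simp [hpr]
        split_ifs with h
        · obtain ⟨i, hi⟩ := h
          have := Finset.single_le_sum hnn (Finset.mem_univ i)
          rwa [if_pos hi] at this
        · exact Finset.sum_nonneg hnn
    _ = ∑ i, ∑ y : Fin n → Fin N, (if auxBad P e n y i then ∏ l, P (y l) else 0) :=
        Finset.sum_comm
    _ ≤ ∑ i : Fin N, 2 * Real.exp (-2 * e ^ 2) ^ n :=
        Finset.sum_le_sum fun i _ => aux_tail P hP0 hP1 n i e he
    _ = _ := by simp; ring

lemma aux_real_sum (a x : ℝ) : HasSum (fun n : ℕ => a * (x ^ n / (Nat.factorial n : ℝ)))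
    (a * Real.exp x) := by
  rw [Real.exp_eq_exp_ℝ]
  exact (NormedSpace.expSeries_div_hasSum_exp x).mul_left a

lemma aux_sum (a x : ℝ) (ha : 0 ≤ a) (hx : 0 ≤ x) :
    ∑' n : ℕ, ENNReal.ofReal (a * (x ^ n / (Nat.factorial n : ℝ))) =
      ENNReal.ofReal (a * Real.exp x) := by
  rw [← (aux_real_sum a x).tsum_eq, ENNReal.ofReal_tsum_of_nonneg (fun n => by positivity)
    (aux_real_sum a x).summable]

/-- Probabilistic core of Theorem 2.  Hierarchical request model: the
number of users `n_R` is Poisson with mean `λ_u·π·R²`; conditioned on `n_R`, the number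
of requests `n_p` is Poisson with mean `n_R·λ_r·τ` (so the joint law of `(n_R, n_p)` is
the product of the two Poisson weights); conditioned on `n_p`, the requests
`X_1,…,X_{n_p}` are i.i.d. from the popularity profile `P`.  With
`p̂_i := (1/n_p)·Σ_{l<n_p} 1{X_l = i}` (`:= 0` when `n_p = 0`), for every `ε̄ > 0`,
`Pr{max_i |p̂_i - P_i| > ε̄} ≤ 2N·exp(-λ_u π R²·(1 - exp(-λ_r τ(1 - e^{-2ε̄²}))))`. -/
theorem probabilistic_core_theorem2 (N : ℕ) (hN : 1 ≤ N)
    (P : Fin N → ℝ) (hP0 : ∀ i, 0 ≤ P i) (hP1 : ∑ i, P i = 1)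
    (lamU lamR R τ : ℝ) (hlamU : 0 < lamU) (hlamR : 0 < lamR) (hR : 0 < R) (hτ : 0 ≤ τ)
    {Ω : Type*} [MeasurableSpace Ω] (Pr : Measure Ω) [IsProbabilityMeasure Pr]
    (nR nP : Ω → ℕ) (X : ℕ → Ω → Fin N) (hX : ∀ l, Measurable (X l))
    (hjoint : ∀ k n : ℕ, Pr {ω | nR ω = k ∧ nP ω = n} =
      ENNReal.ofReal
        ((Real.exp (-(lamU * Real.pi * R ^ 2)) * (lamU * Real.pi * R ^ 2) ^ k /
            (Nat.factorial k : ℝ)) *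
          (Real.exp (-((k : ℝ) * (lamR * τ))) * ((k : ℝ) * (lamR * τ)) ^ n /
            (Nat.factorial n : ℝ))))
    (hcondiid : ∀ (n : ℕ) (y : Fin n → Fin N),
      Pr {ω | nP ω = n ∧ ∀ l : Fin n, X l ω = y l} =
        Pr {ω | nP ω = n} * ∏ l, ENNReal.ofReal (P (y l)))
    (εbar : ℝ) (hεbar : 0 < εbar) :
    Pr {ω | ∃ i, εbar <
        |(if nP ω = 0 then 0 else (1 / (nP ω : ℝ)) *
            ∑ l ∈ Finset.range (nP ω), if X l ω = i then (1 : ℝ) else 0) - P i|} ≤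
      ENNReal.ofReal (2 * N *
        Real.exp (-(lamU * Real.pi * R ^ 2) *
          (1 - Real.exp (-(lamR * τ * (1 - Real.exp (-2 * εbar ^ 2))))))) := by
  classical
  set L := lamU * Real.pi * R ^ 2 with hL
  set a := lamR * τ with ha
  set q := Real.exp (-2 * εbar ^ 2) with hq
  have hL0 : 0 ≤ L := by positivity
  have ha0 : 0 ≤ a := by positivity
  have hq0 : 0 ≤ q := (Real.exp_pos _).le
  have step1 : ∀ n : ℕ, Pr {ω | nP ω = n} ≤ ∑' k : ℕ, Pr {ω | nR ω = k ∧ nP ω = n} := by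
    intro n
    refine le_trans (measure_mono ?_) (measure_iUnion_le _)
    intro ω hω
    exact Set.mem_iUnion.mpr ⟨nR ω, rfl, hω⟩
  have step2 : ∀ n : ℕ, Pr (⋃ y : Fin n → Fin N, {ω | (∃ i, auxBad P εbar n y i) ∧
      (nP ω = n ∧ ∀ l : Fin n, X l ω = y l)}) ≤
      Pr {ω | nP ω = n} * ENNReal.ofReal (2 * N * q ^ n) := by
    intro n
    refine (measure_iUnion_le _).trans ?_
    rw [tsum_fintype]
    refine le_trans ?_ (mul_le_mul_right (aux_tail2 P hP0 hP1 n εbar hεbar) _)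
    rw [Finset.mul_sum]
    refine Finset.sum_le_sum fun y _ => ?_
    split_ifs with h
    · rw [← hcondiid]
      exact measure_mono fun ω hω => hω.2
    · simp [h]
  calc _ ≤ Pr (⋃ n : ℕ, ⋃ y : Fin n → Fin N, {ω | (∃ i, auxBad P εbar n y i) ∧
      (nP ω = n ∧ ∀ l : Fin n, X l ω = y l)}) := by
        refine measure_mono fun ω hω => ?_
        obtain ⟨i, hi⟩ := hω
        refine Set.mem_iUnion.mpr ⟨nP ω, Set.mem_iUnion.mpr ⟨fun l => X l ω, ⟨i, ?_⟩, rfl,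
          fun l => rfl⟩⟩
        unfold auxBad
        rw [Finset.sum_range] at hi
        exact hi
    _ ≤ ∑' n : ℕ, Pr {ω | nP ω = n} * ENNReal.ofReal (2 * N * q ^ n) :=
        (measure_iUnion_le _).trans (ENNReal.tsum_le_tsum step2)
    _ ≤ ∑' n : ℕ, ∑' k : ℕ, Pr {ω | nR ω = k ∧ nP ω = n} * ENNReal.ofReal (2 * N * q ^ n) := by
        refine ENNReal.tsum_le_tsum fun n => ?_
        rw [ENNReal.tsum_mul_right]
        exact mul_le_mul_left (step1 n) _
    _ = ∑' k : ℕ, ∑' n : ℕ, Pr {ω | nR ω = k ∧ nP ω = n} * ENNReal.ofReal (2 * N * q ^ n) :=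
        ENNReal.tsum_comm
    _ = ∑' k : ℕ, ENNReal.ofReal ((2 * N * Real.exp (-L)) *
          ((L * Real.exp (-(a * (1 - q)))) ^ k / (Nat.factorial k : ℝ))) := by
        refine tsum_congr fun k => ?_
        have : ∀ n : ℕ, Pr {ω | nR ω = k ∧ nP ω = n} * ENNReal.ofReal (2 * N * q ^ n) =
            ENNReal.ofReal ((2 * N * (Real.exp (-L) * L ^ k / (Nat.factorial k : ℝ)) *
              Real.exp (-((k : ℝ) * a))) * ((k * a * q) ^ n / (Nat.factorial n : ℝ))) := by
          intro n
          rw [hjoint, ← ENNReal.ofReal_mul (by positivity)]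
          congr 1
          rw [mul_pow (k * a) q n]
          ring
        simp_rw [this]
        rw [aux_sum _ _ (by positivity) (by positivity)]
        congr 1
        rw [mul_assoc _ (Real.exp _) (Real.exp _), ← Real.exp_add, mul_pow L, ← Real.exp_nat_mul]
        have : -(k * a) + k * a * q = k * -(a * (1 - q)) := by ring
        rw [this]
        ring
    _ = _ := by
        rw [aux_sum _ _ (by positivity) (by positivity), mul_assoc (2 * (N : ℝ)), ← Real.exp_add]
        congr 3
        ring
end

section
/- (Scaling of the waiting time, inequality (8)) Let N ≥ 1 be an integer, δ ∈ (0,1), ε > 0, λ_r > 0, λ_u > 0, R > 0, B > 0, R₀ > 0, S > 0, and suppose λ_u·π·R² > log(2N/δ). With ε̄ := R₀ε/(2BS) and g* := 1 − exp(−2ε̄²), the waiting-time threshold of Theorem 2 satisfies (1/(λ_r·g*))·log( 1 / (1 − log(2N/δ)/(λ_u·π·R²)) ) ≥ (2B²S²/(π·R²·λ_u·λ_r·R₀²·ε²))·log(2N/δ). In particular, since S ≤ N forces the threshold parameter ε̄ ≥ R₀ε/(2BN), the required waiting time scales as N² when S is of order N. -/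
/-- Scaling of the waiting time (inequality (8)): the waiting-time threshold
of Theorem 2 is at least `(2B²S²/(π R² λ_u λ_r R₀² ε²))·log(2N/δ)`, so it scales as `N²`
when `S` is of order `N`. -/
theorem waiting_time_scaling (N : ℕ) (hN : 1 ≤ N) (δ ε lamR lamU R B R0 S : ℝ)
    (hδ0 : 0 < δ) (hδ1 : δ < 1) (hε : 0 < ε) (hlamR : 0 < lamR) (hlamU : 0 < lamU)
    (hR : 0 < R) (hB : 0 < B) (hR0 : 0 < R0) (hS : 0 < S)
    (ha : Real.log (2 * N / δ) < lamU * Real.pi * R ^ 2) :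
    2 * B ^ 2 * S ^ 2 / (Real.pi * R ^ 2 * lamU * lamR * R0 ^ 2 * ε ^ 2) *
        Real.log (2 * N / δ) ≤
      1 / (lamR * (1 - Real.exp (-2 * (R0 * ε / (2 * B * S)) ^ 2))) *
        Real.log (1 / (1 - Real.log (2 * N / δ) / (lamU * Real.pi * R ^ 2))) := by
  have hN' : (1 : ℝ) ≤ N := by exact_mod_cast hN
  have hL : 0 ≤ Real.log (2 * N / δ) := by
    apply Real.log_nonneg
    rw [le_div_iff₀ hδ0]
    linarith
  generalize Real.log (2 * N / δ) = L at ha hL ⊢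
  have hpi := Real.pi_pos
  have hA : 0 < lamU * Real.pi * R ^ 2 := by positivity
  have hx1 : L / (lamU * Real.pi * R ^ 2) < 1 := (div_lt_one hA).2 ha
  have hx0 : 0 ≤ L / (lamU * Real.pi * R ^ 2) := by positivity
  have hlog : L / (lamU * Real.pi * R ^ 2) ≤
      Real.log (1 / (1 - L / (lamU * Real.pi * R ^ 2))) := by
    rw [one_div, Real.log_inv]
    have h := Real.log_le_sub_one_of_pos (sub_pos.2 hx1)
    linarith
  have hy : 0 < 2 * (R0 * ε / (2 * B * S)) ^ 2 := by positivity
  have hg0 : 0 < 1 - Real.exp (-2 * (R0 * ε / (2 * B * S)) ^ 2) := by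
    rw [sub_pos, Real.exp_lt_one_iff]
    linarith
  have hg1 : 1 - Real.exp (-2 * (R0 * ε / (2 * B * S)) ^ 2) ≤
      2 * (R0 * ε / (2 * B * S)) ^ 2 := by
    have h := Real.add_one_le_exp (-2 * (R0 * ε / (2 * B * S)) ^ 2)
    linarith
  calc _ = 1 / (lamR * (2 * (R0 * ε / (2 * B * S)) ^ 2)) *
        (L / (lamU * Real.pi * R ^ 2)) := by
        field_simp
        try ring
    _ ≤ _ := by
        apply mul_le_mul _ hlog hx0 (by positivity)
        apply one_div_le_one_div_of_le (by positivity)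
        exact mul_le_mul_of_nonneg_left hg1 hlamR.le
end

section
/- (Concentration of the transfer-learning estimator for fixed sample sizes) Let N ≥ 1, let P, Q ∈ Δ_N, let n, m be natural numbers with n+m ≥ 1, let X_1,…,X_n be i.i.d. from P and Y_1,…,Y_m be i.i.d. from Q, all independent, and define p̂^{tl}_i := (Σ_{l=1}^n 1{X_l=i} + Σ_{k=1}^m 1{Y_k=i})/(n+m). Then for every ε̄ > ‖P−Q‖_H, Pr{ max_{1≤i≤N} |p̂^{tl}_i − p_i| > ε̄ } ≤ 2N·exp(−2·(ε̄ − ‖P−Q‖_H)²·(n+m)). -/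
open MeasureTheory

lemma aux_indep {N : ℕ} {Ω ι : Type*} [Fintype ι] [MeasurableSpace Ω] (μ : Measure Ω)
    [IsProbabilityMeasure μ] (R : ι → Fin N → ℝ) (hR0 : ∀ s i, 0 ≤ R s i)
    (hR1 : ∀ s, ∑ i, R s i = 1) (Z : ι → Ω → Fin N) (hZ : ∀ s, Measurable (Z s))
    (h : ∀ z : ι → Fin N, μ {ω | ∀ s, Z s ω = z s} = ∏ s, ENNReal.ofReal (R s (z s))) :
    ProbabilityTheory.iIndepFun Z μ ∧
      ∀ s i, μ.map (Z s) {i} = ENNReal.ofReal (R s i) := by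
  classical
  let ν : ι → Measure (Fin N) := fun s => ∑ j, ENNReal.ofReal (R s j) • Measure.dirac j
  have hν : ∀ s i, ν s {i} = ENNReal.ofReal (R s i) := by
    intro s i
    simp only [ν, Measure.coe_finset_sum, Finset.sum_apply, Measure.smul_apply, smul_eq_mul]
    rw [Finset.sum_eq_single i]
    · simp
    · intro b _ hb
      simp [hb]
    · simp
  have hprob : ∀ s, IsProbabilityMeasure (ν s) := by
    intro s
    constructor
    simp only [ν, Measure.coe_finset_sum, Finset.sum_apply, Measure.smul_apply, smul_eq_mul,
      measure_univ, mul_one]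
    rw [← ENNReal.ofReal_sum_of_nonneg (fun i _ => hR0 s i), hR1, ENNReal.ofReal_one]
  have hmap : μ.map (fun ω s => Z s ω) = Measure.pi ν := by
    apply Measure.ext_of_singleton
    intro z
    rw [Measure.map_apply (measurable_pi_lambda _ hZ) (measurableSet_singleton z),
      Measure.pi_singleton]
    simp_rw [hν]
    rw [← h z]
    congr 1
    ext ω
    simp [funext_iff]
  have hm : ∀ s, μ.map (Z s) = ν s := by
    intro s
    have := congrArg (Measure.map (Function.eval s)) hmap
    rw [Measure.map_map (measurable_pi_apply s) (measurable_pi_lambda _ hZ),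
      (measurePreserving_eval ν s).map_eq] at this
    exact this
  refine ⟨?_, fun s i => by rw [hm, hν]⟩
  rw [ProbabilityTheory.iIndepFun_iff_map_fun_eq_pi_map (fun s => (hZ s).aemeasurable), hmap]
  simp_rw [hm]

lemma aux_hoeff_s11 {N : ℕ} {Ω ι : Type*} [Fintype ι] [MeasurableSpace Ω] (μ : Measure Ω)
    [IsProbabilityMeasure μ] (R : ι → Fin N → ℝ) (hR0 : ∀ s i, 0 ≤ R s i)
    (hR1 : ∀ s, ∑ i, R s i = 1) (Z : ι → Ω → Fin N) (hZ : ∀ s, Measurable (Z s))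
    (h : ∀ z : ι → Fin N, μ {ω | ∀ s, Z s ω = z s} = ∏ s, ENNReal.ofReal (R s (z s)))
    (hK : 0 < (Fintype.card ι : ℝ)) (i : Fin N) (δ : ℝ) (hδ : 0 ≤ δ) :
    μ {ω | δ * Fintype.card ι ≤ |∑ s, ((if Z s ω = i then (1 : ℝ) else 0) - R s i)|} ≤
      ENNReal.ofReal (2 * Real.exp (-2 * δ ^ 2 * Fintype.card ι)) := by
  obtain ⟨hi, hm⟩ := aux_indep μ R hR0 hR1 Z hZ h
  have hf : ∀ s, Measurable (fun j : Fin N => (if j = i then (1 : ℝ) else 0) - R s i) :=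
    fun s => measurable_of_finite _
  have hind := hi.comp (fun s j => (if j = i then (1 : ℝ) else 0) - R s i) hf
  have hint : ∀ s, ∫ ω, (if Z s ω = i then (1 : ℝ) else 0) ∂μ = R s i := by
    intro s
    have h1 := hm s i
    rw [Measure.map_apply (hZ s) (measurableSet_singleton i)] at h1
    have : (fun ω => if Z s ω = i then (1 : ℝ) else 0) =
        (Z s ⁻¹' {i}).indicator 1 := by
      ext ω; simp [Set.indicator]
    rw [this, integral_indicator_one (hZ s (measurableSet_singleton i)), Measure.real, h1,
      ENNReal.toReal_ofReal (hR0 s i)]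
  have hsub : ∀ s, ProbabilityTheory.HasSubgaussianMGF
      (fun ω => (if Z s ω = i then (1 : ℝ) else 0) - R s i) (1/4) μ := by
    intro s
    have := ProbabilityTheory.hasSubgaussianMGF_of_mem_Icc (μ := μ) (a := 0) (b := 1)
      (X := fun ω => (if Z s ω = i then (1 : ℝ) else 0))
      ((measurable_of_finite (fun j : Fin N => (if j = i then (1 : ℝ) else 0))).comp
        (hZ s)).aemeasurable
      (Filter.Eventually.of_forall fun ω => by split_ifs <;> simp)
    rw [hint s] at this
    convert this using 1
    simp
    norm_num
  have hS := ProbabilityTheory.HasSubgaussianMGF.sum_of_iIndepFun hind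
    (s := Finset.univ) (c := fun _ => 1/4) (fun s _ => hsub s)
  have hp : 0 ≤ δ * (Fintype.card ι : ℝ) := by positivity
  have e : -(δ * (Fintype.card ι : ℝ)) ^ 2 / (2 * ((∑ s : ι, (1/4 : NNReal) : NNReal) : ℝ)) =
      -2 * δ ^ 2 * Fintype.card ι := by
    simp
    field_simp
    ring
  have b1 := hS.measure_ge_le hp
  have b2 := hS.neg.measure_ge_le hp
  rw [e] at b1 b2
  rw [← ENNReal.ofReal_toReal (measure_ne_top μ _)]
  apply ENNReal.ofReal_le_ofReal
  change μ.real _ ≤ _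
  rw [two_mul]
  refine le_trans (le_trans (measureReal_mono ?_) (measureReal_union_le _ _)) (add_le_add b1 b2)
  intro ω hω
  simp only [Set.mem_setOf_eq, le_abs] at hω
  simpa using hω

/-- Concentration of the transfer-learning estimator for fixed sample
sizes: with `X_1,…,X_n` i.i.d. from `P`, `Y_1,…,Y_m` i.i.d. from `Q`, all independent,
and `p̂^{tl}_i := (Σ_l 1{X_l=i} + Σ_k 1{Y_k=i})/(n+m)`, for every
`ε̄ > ‖P-Q‖_H := max_j |P_j - Q_j|`,
`Pr{max_i |p̂^{tl}_i - P_i| > ε̄} ≤ 2N·exp(-2(ε̄ - ‖P-Q‖_H)²(n+m))`. -/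
theorem tl_estimator_concentration (N : ℕ) (hN : 1 ≤ N)
    {Ω : Type*} [MeasurableSpace Ω] (μ : Measure Ω) [IsProbabilityMeasure μ]
    (P Q : Fin N → ℝ) (hP0 : ∀ i, 0 ≤ P i) (hP1 : ∑ i, P i = 1)
    (hQ0 : ∀ i, 0 ≤ Q i) (hQ1 : ∑ i, Q i = 1)
    (n m : ℕ) (hnm : 1 ≤ n + m)
    (X : Fin n → Ω → Fin N) (Y : Fin m → Ω → Fin N)
    (hX : ∀ l, Measurable (X l)) (hY : ∀ k, Measurable (Y k))
    (hindep : ∀ (x : Fin n → Fin N) (y : Fin m → Fin N),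
      μ {ω | (∀ l, X l ω = x l) ∧ ∀ k, Y k ω = y k} =
        (∏ l, ENNReal.ofReal (P (x l))) * ∏ k, ENNReal.ofReal (Q (y k)))
    (εbar : ℝ) (hεbar : (⨆ j, |P j - Q j|) < εbar) :
    μ {ω | ∃ i, εbar <
        |((∑ l, (if X l ω = i then (1 : ℝ) else 0)) +
            ∑ k, (if Y k ω = i then (1 : ℝ) else 0)) / ((n : ℝ) + m) - P i|} ≤
      ENNReal.ofReal (2 * N *
        Real.exp (-2 * (εbar - ⨆ j, |P j - Q j|) ^ 2 * ((n : ℝ) + m))) := by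
  classical
  set D := ⨆ j, |P j - Q j| with hD
  have hDle : ∀ i, |P i - Q i| ≤ D := fun i =>
    le_ciSup (f := fun j => |P j - Q j|) (Set.finite_range _).bddAbove i
  have hK : (0 : ℝ) < (n : ℝ) + m := by exact_mod_cast hnm
  let R : Fin n ⊕ Fin m → Fin N → ℝ := Sum.elim (fun _ => P) (fun _ => Q)
  let Z : Fin n ⊕ Fin m → Ω → Fin N := Sum.elim X Y
  have hcard : (Fintype.card (Fin n ⊕ Fin m) : ℝ) = (n : ℝ) + m := by simp
  have key := fun i => aux_hoeff_s11 μ R (by rintro (s | s) i <;> simp [R, hP0, hQ0])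
    (by rintro (s | s) <;> simp [R, hP1, hQ1]) Z (by rintro (s | s) <;> simp [Z, hX, hY])
    (by
      intro z
      have := hindep (fun l => z (Sum.inl l)) (fun k => z (Sum.inr k))
      simpa [Z, R, Fintype.prod_sum_type] using this)
    (by rw [hcard]; exact hK) i (εbar - D) (by linarith)
  simp only [hcard, Fintype.sum_sum_type, Z, R, Sum.elim_inl, Sum.elim_inr,
    Finset.sum_sub_distrib, Finset.sum_const, Finset.card_univ, Fintype.card_fin,
    nsmul_eq_mul] at key
  calc _ ≤ μ (⋃ i, {ω | (εbar - D) * ((n : ℝ) + m) ≤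
        |(∑ l, (if X l ω = i then (1 : ℝ) else 0)) - n * P i +
            ((∑ k, (if Y k ω = i then (1 : ℝ) else 0)) - m * Q i)|}) := by
        apply measure_mono
        rintro ω ⟨i, hi⟩
        refine Set.mem_iUnion.2 ⟨i, ?_⟩
        simp only [Set.mem_setOf_eq]
        generalize (∑ l, (if X l ω = i then (1 : ℝ) else 0)) = A at *
        generalize (∑ k, (if Y k ω = i then (1 : ℝ) else 0)) = B at *
        have e1 : (A + B) / ((n : ℝ) + m) - P i =
            (A + B - (n + m) * P i) / ((n : ℝ) + m) := by field_simp
        rw [e1, abs_div, abs_of_pos hK, lt_div_iff₀ hK] at hi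
        have e2 : A + B - (n + m) * P i =
            (A - n * P i + (B - m * Q i)) - m * (P i - Q i) := by ring
        have h3 := abs_sub (A - n * P i + (B - m * Q i)) (m * (P i - Q i))
        rw [← e2, abs_mul, Nat.abs_cast] at h3
        have h4 : (m : ℝ) * |P i - Q i| ≤ m * D :=
          mul_le_mul_of_nonneg_left (hDle i) (Nat.cast_nonneg m)
        have h5 : 0 ≤ (n : ℝ) * D :=
          mul_nonneg (Nat.cast_nonneg n) ((abs_nonneg _).trans (hDle i))
        linarith
    _ ≤ ∑ i : Fin N, _ := measure_iUnion_fintype_le _ _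
    _ ≤ ∑ i : Fin N, ENNReal.ofReal (2 * Real.exp (-2 * (εbar - D) ^ 2 * ((n : ℝ) + m))) :=
        Finset.sum_le_sum fun i _ => by
          refine le_trans (le_of_eq ?_) (key i)
          congr 1
          ext ω
          simp only [add_sub_add_comm]
          rfl
    _ = _ := by
        rw [← ENNReal.ofReal_sum_of_nonneg (fun i _ => by positivity)]
        congr 1
        simp
        ring
end

section
/- (Probabilistic core of Theorem 3) Under the hierarchical request model with m additional source-domain samples, for every ε̄ > ‖P−Q‖_H and with ε_pq := ε̄ − ‖P−Q‖_H, Pr{ max_{1≤i≤N} |p̂^{tl}_i − p_i| > ε̄ } ≤ 2N·exp(−2ε_pq²·m)·exp(−λ_u·π·R²·(1 − exp(−λ_r·τ·(1 − e^{−2ε_pq²})))). -/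
open MeasureTheory
theorem hoeff_aux (p : ℝ) (h0 : 0 ≤ p) (h1 : p ≤ 1) (t : ℝ) :
    p * Real.exp (t * (1 - p)) + (1 - p) * Real.exp (t * (0 - p)) ≤ Real.exp (t ^ 2 / 8) := by
  let μ : Measure ℝ := ENNReal.ofReal p • Measure.dirac 1 + ENNReal.ofReal (1 - p) • Measure.dirac 0
  have hint : ∀ f : ℝ → ℝ, ∫ x, f x ∂μ = p * f 1 + (1 - p) * f 0 := by
    intro f
    have e1 : Integrable f (ENNReal.ofReal p • Measure.dirac 1) :=
      (integrable_dirac (by simp)).smul_measure ENNReal.ofReal_ne_top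
    have e2 : Integrable f (ENNReal.ofReal (1-p) • Measure.dirac 0) :=
      (integrable_dirac (by simp)).smul_measure ENNReal.ofReal_ne_top
    simp only [μ]
    rw [integral_add_measure e1 e2, integral_smul_measure, integral_smul_measure]
    simp [ENNReal.toReal_ofReal, h0, h1]
  have : IsProbabilityMeasure μ := ⟨by
    simp only [μ]
    simp
    rw [← ENNReal.ofReal_add h0 (by linarith)]; simp⟩
  have hs := ProbabilityTheory.hasSubgaussianMGF_of_mem_Icc (μ := μ) (X := fun x => x)
    (a := 0) (b := 1) (by fun_prop) (by
      rw [ae_iff]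
      simp only [μ]
      simp [Set.indicator])
  have := hs.mgf_le t
  simp only [ProbabilityTheory.mgf, hint] at this
  refine le_trans (le_of_eq ?_) (this.trans (le_of_eq ?_))
  · simp
  · congr 1
    simp
    ring

theorem wsum_aux {N : ℕ} (P : Fin N → ℝ) (hP0 : ∀ i, 0 ≤ P i) (hP1 : ∑ i, P i = 1) (i : Fin N)
    (t : ℝ) : ∑ j, P j * Real.exp (t * ((if j = i then 1 else 0) - P i)) ≤ Real.exp (t ^ 2 / 8) := by
  have hle : P i ≤ 1 := hP1 ▸ Finset.single_le_sum (fun j _ => hP0 j) (Finset.mem_univ i)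
  refine le_trans (le_of_eq ?_) (hoeff_aux (P i) (hP0 i) hle t)
  rw [← Finset.add_sum_erase _ _ (Finset.mem_univ i)] at hP1 ⊢
  rw [Finset.sum_congr rfl (g := fun j => P j * Real.exp (t * (0 - P i))), ← Finset.sum_mul]
  · rw [show 1 - P i = ∑ x ∈ Finset.univ.erase i, P x by linarith]
    simp only [if_true]
    rw [show ∑ x ∈ Finset.univ.erase i, P x = 1 - P i by linarith]
  · intro j hj
    rw [if_neg (Finset.ne_of_mem_erase hj)]

theorem pow_aux {N : ℕ} (P : Fin N → ℝ) (hP0 : ∀ i, 0 ≤ P i) (hP1 : ∑ i, P i = 1) (i : Fin N)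
    (t : ℝ) (n : ℕ) :
    ∑ x : Fin n → Fin N, (∏ l, P (x l)) *
      Real.exp (t * ((∑ l, if x l = i then 1 else 0) - n * P i)) ≤ Real.exp (n * (t ^ 2 / 8)) := by
  rw [Real.exp_nat_mul]
  refine le_trans (le_of_eq ?_) (pow_le_pow_left₀ (Finset.sum_nonneg fun j _ => mul_nonneg (hP0 j) (Real.exp_nonneg _)) (wsum_aux P hP0 hP1 i t) n)
  rw [Fintype.sum_pow]
  refine Finset.sum_congr rfl fun x _ => ?_
  rw [Finset.prod_mul_distrib, ← Real.exp_sum, ← Finset.mul_sum, Finset.sum_sub_distrib]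
  simp

theorem pair_aux {N : ℕ} (P Q : Fin N → ℝ) (hP0 : ∀ i, 0 ≤ P i) (hP1 : ∑ i, P i = 1)
    (hQ0 : ∀ i, 0 ≤ Q i) (hQ1 : ∑ i, Q i = 1) (i : Fin N)
    (t : ℝ) (n m : ℕ) (d : ℝ) :
    ∑ z : (Fin n → Fin N) × (Fin m → Fin N), ((∏ l, P (z.1 l)) * ∏ k, Q (z.2 k)) *
      Real.exp (t * ((∑ l, if z.1 l = i then 1 else 0) + (∑ k, if z.2 k = i then 1 else 0)
        - n * P i - m * Q i) - d) ≤ Real.exp ((n + m) * (t ^ 2 / 8) - d) := by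
  have h := mul_le_mul (pow_aux P hP0 hP1 i t n) (pow_aux Q hQ0 hQ1 i t m)
    (Finset.sum_nonneg fun y _ => mul_nonneg (Finset.prod_nonneg fun k _ => hQ0 _) (Real.exp_nonneg _))
    (Real.exp_nonneg _)
  have h2 := mul_le_mul_of_nonneg_right h (Real.exp_nonneg (-d))
  refine le_trans (le_of_eq ?_) (h2.trans (le_of_eq ?_))
  · rw [Finset.sum_mul_sum, Fintype.sum_prod_type, Finset.sum_mul]
    refine Finset.sum_congr rfl fun x _ => ?_
    rw [Finset.sum_mul]
    refine Finset.sum_congr rfl fun y _ => ?_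
    rw [mul_mul_mul_comm, ← Real.exp_add, mul_assoc _ _ (Real.exp (-d)), ← Real.exp_add]
    congr 2
    ring
  · rw [← Real.exp_add, ← Real.exp_add]
    congr 1
    ring

theorem bad_aux {N : ℕ} (P Q : Fin N → ℝ) (hP0 : ∀ i, 0 ≤ P i) (hP1 : ∑ i, P i = 1)
    (hQ0 : ∀ i, 0 ≤ Q i) (hQ1 : ∑ i, Q i = 1) (n m : ℕ) (ε : ℝ) (hε : 0 < ε)
    (B : Finset ((Fin n → Fin N) × (Fin m → Fin N)))
    (hB : ∀ z ∈ B, ∃ i, (n + m) * ε ≤ |(∑ l, if z.1 l = i then (1:ℝ) else 0) +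
      (∑ k, if z.2 k = i then (1:ℝ) else 0) - n * P i - m * Q i|) :
    ∑ z ∈ B, ((∏ l, P (z.1 l)) * ∏ k, Q (z.2 k)) ≤
      2 * N * Real.exp (-2 * ε ^ 2 * m) * Real.exp (-2 * ε ^ 2) ^ n := by
  have hw : ∀ z : (Fin n → Fin N) × (Fin m → Fin N),
      0 ≤ (∏ l, P (z.1 l)) * ∏ k, Q (z.2 k) := fun z =>
    mul_nonneg (Finset.prod_nonneg fun k _ => hP0 _) (Finset.prod_nonneg fun k _ => hQ0 _)
  set D : (Fin n → Fin N) × (Fin m → Fin N) → Fin N → ℝ := fun z i =>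
    (∑ l, if z.1 l = i then (1:ℝ) else 0) +
      (∑ k, if z.2 k = i then (1:ℝ) else 0) - n * P i - m * Q i with hD
  set d := 4 * ε * ((n + m) * ε) with hd
  calc ∑ z ∈ B, ((∏ l, P (z.1 l)) * ∏ k, Q (z.2 k))
      ≤ ∑ z ∈ B, ((∏ l, P (z.1 l)) * ∏ k, Q (z.2 k)) *
        ∑ i, (Real.exp (4 * ε * D z i - d) + Real.exp (-(4 * ε) * D z i - d)) := by
        refine Finset.sum_le_sum fun z hz => ?_
        refine le_mul_of_one_le_right (hw z) ?_
        obtain ⟨i, hi⟩ := hB z hz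
        change _ ≤ |D z i| at hi
        refine le_trans ?_ (Finset.single_le_sum (fun j _ => by positivity) (Finset.mem_univ i))
        rcases le_abs.1 hi with h | h
        · have : 1 ≤ Real.exp (4 * ε * D z i - d) := by
            apply Real.one_le_exp
            rw [hd]; nlinarith
          linarith [Real.exp_nonneg (-(4 * ε) * D z i - d)]
        · have : 1 ≤ Real.exp (-(4 * ε) * D z i - d) := by
            apply Real.one_le_exp
            rw [hd]; nlinarith
          linarith [Real.exp_nonneg (4 * ε * D z i - d)]
    _ ≤ ∑ z, ((∏ l, P (z.1 l)) * ∏ k, Q (z.2 k)) *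
        ∑ i, (Real.exp (4 * ε * D z i - d) + Real.exp (-(4 * ε) * D z i - d)) := by
        refine Finset.sum_le_univ_sum_of_nonneg fun z => mul_nonneg (hw z) ?_
        exact Finset.sum_nonneg fun i _ => by positivity
    _ = ∑ i, (∑ z, ((∏ l, P (z.1 l)) * ∏ k, Q (z.2 k)) * Real.exp (4 * ε * D z i - d) +
          ∑ z, ((∏ l, P (z.1 l)) * ∏ k, Q (z.2 k)) * Real.exp (-(4 * ε) * D z i - d)) := by
        simp_rw [Finset.mul_sum, mul_add]
        rw [Finset.sum_comm]
        simp_rw [Finset.sum_add_distrib]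
    _ ≤ ∑ i : Fin N, (Real.exp ((n + m) * ((4 * ε) ^ 2 / 8) - d) +
          Real.exp ((n + m) * ((-(4 * ε)) ^ 2 / 8) - d)) :=
        Finset.sum_le_sum fun i _ => add_le_add
          (pair_aux P Q hP0 hP1 hQ0 hQ1 i (4 * ε) n m d)
          (pair_aux P Q hP0 hP1 hQ0 hQ1 i (-(4 * ε)) n m d)
    _ = _ := by
        rw [Finset.sum_const, ← Real.exp_nat_mul, mul_assoc, ← Real.exp_add]
        rw [show (n + m) * ((4 * ε) ^ 2 / 8) - d = -2 * ε ^ 2 * m + n * (-2 * ε ^ 2) by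
          rw [hd]; ring, show (n + m) * ((-(4 * ε)) ^ 2 / 8) - d = -2 * ε ^ 2 * m + n * (-2 * ε ^ 2) by
          rw [hd]; ring]
        simp
        ring

theorem pois_aux (L c : ℝ) :
    HasSum (fun n : ℕ => Real.exp (-L) * L ^ n / (Nat.factorial n : ℝ) * c ^ n)
      (Real.exp (-(L * (1 - c)))) := by
  have h := (NormedSpace.expSeries_div_hasSum_exp (L * c)).mul_left (Real.exp (-L))
  rw [← Real.exp_eq_exp_ℝ, ← Real.exp_add] at h
  have e : -(L * (1 - c)) = -L + L * c := by ring
  rw [e]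
  have e2 : (fun n : ℕ => Real.exp (-L) * L ^ n / (Nat.factorial n : ℝ) * c ^ n) =
      fun n : ℕ => Real.exp (-L) * ((L * c) ^ n / (Nat.factorial n : ℝ)) := by
    funext n
    rw [mul_pow]; ring
  rw [e2]
  exact h

theorem sum_aux (Λ L c K : ℝ) (hΛ : 0 ≤ Λ) (hL : 0 ≤ L) (hc : 0 ≤ c) (hK : 0 ≤ K) :
    ∑' n : ℕ, (∑' k : ℕ, ENNReal.ofReal ((Real.exp (-Λ) * Λ ^ k / (Nat.factorial k : ℝ)) *
          (Real.exp (-((k : ℝ) * L)) * ((k : ℝ) * L) ^ n / (Nat.factorial n : ℝ)))) *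
        ENNReal.ofReal (K * c ^ n) =
      ENNReal.ofReal (K * Real.exp (-Λ * (1 - Real.exp (-(L * (1 - c)))))) := by
  simp_rw [← ENNReal.tsum_mul_right]
  rw [ENNReal.tsum_comm]
  have h1 : ∀ k : ℕ, ∑' n : ℕ, ENNReal.ofReal ((Real.exp (-Λ) * Λ ^ k / (Nat.factorial k : ℝ)) *
          (Real.exp (-((k : ℝ) * L)) * ((k : ℝ) * L) ^ n / (Nat.factorial n : ℝ))) *
        ENNReal.ofReal (K * c ^ n) =
      ENNReal.ofReal (K * ((Real.exp (-Λ) * Λ ^ k / (Nat.factorial k : ℝ)) *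
        Real.exp (-(L * (1 - c))) ^ k)) := by
    intro k
    have hs := (pois_aux (k * L) c).mul_left (K * (Real.exp (-Λ) * Λ ^ k / (Nat.factorial k : ℝ)))
    have e : K * ((Real.exp (-Λ) * Λ ^ k / (Nat.factorial k : ℝ)) *
        Real.exp (-(L * (1 - c))) ^ k) = K * (Real.exp (-Λ) * Λ ^ k / (Nat.factorial k : ℝ)) *
        Real.exp (-(k * L * (1 - c))) := by
      rw [← Real.exp_nat_mul, mul_assoc]
      congr 3
      ring
    rw [e, ← hs.tsum_eq, ENNReal.ofReal_tsum_of_nonneg (fun n => by positivity) hs.summable]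
    refine tsum_congr fun n => ?_
    rw [← ENNReal.ofReal_mul (by positivity)]
    congr 1
    ring
  simp_rw [h1]
  have hs := (pois_aux Λ (Real.exp (-(L * (1 - c))))).mul_left K
  rw [neg_mul, ← hs.tsum_eq, ENNReal.ofReal_tsum_of_nonneg (fun n => by positivity) hs.summable]

/-- Probabilistic core of Theorem 3.  Hierarchical request model with `m`
additional source-domain samples: the joint law of `(n_R, n_p)` is the product of the
Poisson(`λ_u π R²`) and Poisson(`n_R λ_r τ`) weights; conditioned on `n_p`, the requests
`X_1,…,X_{n_p}` are i.i.d. from `P` and, independently, `Y_1,…,Y_m` are i.i.d. from `Q`.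
With `p̂^{tl}_i := (Σ_{l<n_p} 1{X_l=i} + Σ_k 1{Y_k=i})/(n_p+m)` (`:= 0` when
`n_p+m = 0`), for every `ε̄ > ‖P-Q‖_H := max_j |P_j - Q_j|` and
`ε_pq := ε̄ - ‖P-Q‖_H`,
`Pr{max_i |p̂^{tl}_i - P_i| > ε̄} ≤
  2N·e^{-2ε_pq²m}·exp(-λ_u π R²·(1 - exp(-λ_r τ(1 - e^{-2ε_pq²}))))`. -/
theorem probabilistic_core_theorem3 (N : ℕ) (hN : 1 ≤ N)
    (P Q : Fin N → ℝ) (hP0 : ∀ i, 0 ≤ P i) (hP1 : ∑ i, P i = 1)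
    (hQ0 : ∀ i, 0 ≤ Q i) (hQ1 : ∑ i, Q i = 1)
    (lamU lamR R τ : ℝ) (hlamU : 0 < lamU) (hlamR : 0 < lamR) (hR : 0 < R) (hτ : 0 ≤ τ)
    (m : ℕ)
    {Ω : Type*} [MeasurableSpace Ω] (Pr : Measure Ω) [IsProbabilityMeasure Pr]
    (nR nP : Ω → ℕ) (X : ℕ → Ω → Fin N) (Y : Fin m → Ω → Fin N)
    (hX : ∀ l, Measurable (X l)) (hY : ∀ k, Measurable (Y k))
    (hjoint : ∀ k n : ℕ, Pr {ω | nR ω = k ∧ nP ω = n} =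
      ENNReal.ofReal
        ((Real.exp (-(lamU * Real.pi * R ^ 2)) * (lamU * Real.pi * R ^ 2) ^ k /
            (Nat.factorial k : ℝ)) *
          (Real.exp (-((k : ℝ) * (lamR * τ))) * ((k : ℝ) * (lamR * τ)) ^ n /
            (Nat.factorial n : ℝ))))
    (hcondiid : ∀ (n : ℕ) (x : Fin n → Fin N) (y : Fin m → Fin N),
      Pr {ω | nP ω = n ∧ (∀ l : Fin n, X l ω = x l) ∧ ∀ k, Y k ω = y k} =
        Pr {ω | nP ω = n} * (∏ l, ENNReal.ofReal (P (x l))) *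
          ∏ k, ENNReal.ofReal (Q (y k)))
    (εbar : ℝ) (hεbar : (⨆ j, |P j - Q j|) < εbar) :
    Pr {ω | ∃ i, εbar <
        |(if nP ω + m = 0 then 0 else
            ((∑ l ∈ Finset.range (nP ω), if X l ω = i then (1 : ℝ) else 0) +
              ∑ k, (if Y k ω = i then (1 : ℝ) else 0)) / ((nP ω : ℝ) + m)) - P i|} ≤
      ENNReal.ofReal (2 * N *
        Real.exp (-2 * (εbar - ⨆ j, |P j - Q j|) ^ 2 * m) *
        Real.exp (-(lamU * Real.pi * R ^ 2) *
          (1 - Real.exp (-(lamR * τ *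
            (1 - Real.exp (-2 * (εbar - ⨆ j, |P j - Q j|) ^ 2))))))) := by
  classical
  set δ := ⨆ j, |P j - Q j| with hδ
  have hδle : ∀ j, |P j - Q j| ≤ δ := fun j =>
    le_ciSup (f := fun j => |P j - Q j|) (Set.finite_range _).bddAbove j
  set ε := εbar - δ with hε
  have hεpos : 0 < ε := by rw [hε]; linarith
  let S : (n : ℕ) → (Fin n → Fin N) × (Fin m → Fin N) → Fin N → ℝ := fun n z i =>
    (∑ l, if z.1 l = i then (1:ℝ) else 0) + (∑ k, if z.2 k = i then (1:ℝ) else 0)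
  let B : (n : ℕ) → Finset ((Fin n → Fin N) × (Fin m → Fin N)) := fun n =>
    Finset.univ.filter fun z => ∃ i,
      εbar < |(if n + m = 0 then 0 else S n z i / ((n : ℝ) + m)) - P i|
  have hB : ∀ n, ∑ z ∈ B n, ((∏ l, P (z.1 l)) * ∏ k, Q (z.2 k)) ≤
      2 * N * Real.exp (-2 * ε ^ 2 * m) * Real.exp (-2 * ε ^ 2) ^ n := by
    intro n
    refine bad_aux P Q hP0 hP1 hQ0 hQ1 n m ε hεpos (B n) ?_
    intro z hz
    obtain ⟨i, hi⟩ := (Finset.mem_filter.1 hz).2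
    refine ⟨i, ?_⟩
    change _ ≤ |S n z i - n * P i - m * Q i|
    by_cases h0 : n + m = 0
    · have : (n : ℝ) + m = 0 := by exact_mod_cast h0
      rw [this, zero_mul]; positivity
    · rw [if_neg h0] at hi
      have hpos : (0 : ℝ) < n + m := by exact_mod_cast Nat.pos_of_ne_zero h0
      have e : S n z i / ((n : ℝ) + m) - P i = (S n z i - (n + m) * P i) / (n + m) := by
        field_simp
      rw [e, abs_div, abs_of_pos hpos, lt_div_iff₀ hpos] at hi
      have t : |S n z i - (n + m) * P i| ≤ |S n z i - n * P i - m * Q i| + m * |P i - Q i| := by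
        have : S n z i - (n + m) * P i = (S n z i - n * P i - m * Q i) - m * (P i - Q i) := by ring
        rw [this]
        refine (abs_sub _ _).trans ?_
        rw [abs_mul, Nat.abs_cast]
      have hm : (m : ℝ) * |P i - Q i| ≤ m * δ := by gcongr; exact hδle i
      have hδ0 : 0 ≤ δ := (abs_nonneg _).trans (hδle i)
      have hn : 0 ≤ (n : ℝ) * δ := by positivity
      rw [hε]
      nlinarith
  have hnP : ∀ n, Pr {ω | nP ω = n} ≤ ∑' k, Pr {ω | nR ω = k ∧ nP ω = n} := by
    intro n
    refine le_trans (measure_mono ?_) (measure_iUnion_le _)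
    intro ω hω
    exact Set.mem_iUnion.2 ⟨nR ω, rfl, hω⟩
  rw [← sum_aux (lamU * Real.pi * R ^ 2) (lamR * τ) (Real.exp (-2 * ε ^ 2))
    (2 * N * Real.exp (-2 * ε ^ 2 * m)) (by positivity) (by positivity) (by positivity)
    (by positivity)]
  have key : ∀ n, Pr (⋃ z ∈ B n, {ω | nP ω = n ∧ (∀ l : Fin n, X l ω = z.1 l) ∧
      ∀ k, Y k ω = z.2 k}) ≤ (∑' k, Pr {ω | nR ω = k ∧ nP ω = n}) *
        ENNReal.ofReal (2 * N * Real.exp (-2 * ε ^ 2 * m) * Real.exp (-2 * ε ^ 2) ^ n) := by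
    intro n
    refine (measure_biUnion_finset_le _ _).trans ?_
    calc _ = ∑ z ∈ B n, Pr {ω | nP ω = n} *
          ENNReal.ofReal ((∏ l, P (z.1 l)) * ∏ k, Q (z.2 k)) := by
          refine Finset.sum_congr rfl fun z _ => ?_
          rw [hcondiid, ENNReal.ofReal_mul (Finset.prod_nonneg fun l _ => hP0 _),
            ENNReal.ofReal_prod_of_nonneg (fun l _ => hP0 _),
            ENNReal.ofReal_prod_of_nonneg (fun l _ => hQ0 _), mul_assoc]
      _ = Pr {ω | nP ω = n} * ENNReal.ofReal (∑ z ∈ B n, ((∏ l, P (z.1 l)) * ∏ k, Q (z.2 k))) := by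
          rw [← Finset.mul_sum, ENNReal.ofReal_sum_of_nonneg]
          exact fun z _ => mul_nonneg (Finset.prod_nonneg fun k _ => hP0 _)
            (Finset.prod_nonneg fun k _ => hQ0 _)
      _ ≤ _ := mul_le_mul' (hnP n) (ENNReal.ofReal_le_ofReal (hB n))
  simp_rw [hjoint] at key
  refine le_trans (le_trans (measure_mono ?_) (measure_iUnion_le _)) (ENNReal.tsum_le_tsum key)
  rintro ω ⟨i, hi⟩
  refine Set.mem_iUnion.2 ⟨nP ω, Set.mem_iUnion₂.2
    ⟨(fun l => X l ω, fun k => Y k ω), ?_, rfl, fun l => rfl, fun k => rfl⟩⟩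
  refine Finset.mem_filter.2 ⟨Finset.mem_univ _, i, ?_⟩
  simp only [S]
  rw [Finset.sum_range] at hi
  exact hi
end

section
/- (Proposition 1: transfer learning beats target-only learning given enough source samples) Let N ≥ 1 be an integer, δ ∈ (0,1), λ_r > 0, a > log(2N/δ), and let ε̄ ≥ ε_pq > 0. Set 𝓛 := log(2N/δ)/a ∈ (0,1), α := 1 − e^{−2ε_pq²}, β := 1 − e^{−2ε̄²} (so 0 < α ≤ β), F := a·(1 − (1−𝓛)^{α/β}), and Λ := (log(2N/δ) − 2ε_pq²·m)/a. If the number of source-domain samples m ∈ ℕ satisfies m ≥ (1/(2ε_pq²))·max(0, log(2N/δ) − F), then the transfer-learning waiting-time threshold is no larger than the target-only threshold: max(0, (1/(λ_r·α))·log(1/(1−Λ))) ≤ max(0, (1/(λ_r·β))·log(1/(1−𝓛))). -/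
/-- Proposition 1: given enough source-domain samples
`m ≥ (1/(2ε_pq²))·max(0, log(2N/δ) - F)` with
`F := a·(1 - (1-𝓛)^(α/β))`, `𝓛 := log(2N/δ)/a`, `α := 1-e^{-2ε_pq²}`, `β := 1-e^{-2ε̄²}`,
the transfer-learning waiting-time threshold is no larger than the target-only threshold. -/
theorem tl_beats_target_only (N : ℕ) (hN : 1 ≤ N) (δ lamR a εbar εpq : ℝ) (m : ℕ)
    (hδ0 : 0 < δ) (hδ1 : δ < 1) (hlamR : 0 < lamR)
    (ha : Real.log (2 * N / δ) < a) (hεpq : 0 < εpq) (hle : εpq ≤ εbar)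
    (hm : (1 / (2 * εpq ^ 2)) *
        max 0 (Real.log (2 * N / δ) -
          a * (1 - (1 - Real.log (2 * N / δ) / a) ^
            ((1 - Real.exp (-2 * εpq ^ 2)) / (1 - Real.exp (-2 * εbar ^ 2))))) ≤ m) :
    max 0 (1 / (lamR * (1 - Real.exp (-2 * εpq ^ 2))) *
        Real.log (1 / (1 - (Real.log (2 * N / δ) - 2 * εpq ^ 2 * m) / a))) ≤
      max 0 (1 / (lamR * (1 - Real.exp (-2 * εbar ^ 2))) *
        Real.log (1 / (1 - Real.log (2 * N / δ) / a))) := by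
  have hK : 0 < Real.log (2 * N / δ) := by
    apply Real.log_pos
    rw [lt_div_iff₀ hδ0]
    have : (1 : ℝ) ≤ N := by exact_mod_cast hN
    linarith
  have hα : 0 < 1 - Real.exp (-2 * εpq ^ 2) := by
    have : Real.exp (-2 * εpq ^ 2) < 1 := by
      rw [Real.exp_lt_one_iff]
      nlinarith [pow_pos hεpq 2]
    linarith
  have hβ : 0 < 1 - Real.exp (-2 * εbar ^ 2) := by
    have : Real.exp (-2 * εbar ^ 2) < 1 := by
      rw [Real.exp_lt_one_iff]
      nlinarith [pow_pos (hεpq.trans_le hle) 2]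
    linarith
  generalize 1 - Real.exp (-2 * εpq ^ 2) = α at *
  generalize 1 - Real.exp (-2 * εbar ^ 2) = β at *
  generalize Real.log (2 * N / δ) = K at *
  have ha0 : 0 < a := hK.trans ha
  have hL : 0 < 1 - K / a := by
    have : K / a < 1 := by rwa [div_lt_one ha0]
    linarith
  have hX : 0 < (1 - K / a) ^ (α / β) := Real.rpow_pos_of_pos hL _
  have hc : 0 < 2 * εpq ^ 2 := by positivity
  rw [one_div, inv_mul_le_iff₀ hc] at hm
  have h1 := (le_max_right _ _).trans hm
  have h2 : (1 - K / a) ^ (α / β) ≤ 1 - (K - 2 * εpq ^ 2 * m) / a := by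
    have : (K - 2 * εpq ^ 2 * m) / a ≤ 1 - (1 - K / a) ^ (α / β) := by
      rw [div_le_iff₀ ha0]
      linarith
    linarith
  have h3 := Real.log_le_log hX h2
  rw [Real.log_rpow hL] at h3
  apply max_le_max le_rfl
  rw [one_div (1 - K / a), one_div (1 - _ / a), Real.log_inv, Real.log_inv]
  calc _ ≤ 1 / (lamR * α) * -(α / β * Real.log (1 - K / a)) := by gcongr
    _ = _ := by field_simp
end
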